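/- Let G be a finite bipartite simple graph such that every proper 3-coloring of G can be transformed into a proper 3-coloring using at most 2 distinct colors. Then G is 3-mixing, i.e., every proper 3-coloring of G can be transformed into every other proper 3-coloring. -/

import Mathlib

/-- A proper `k`-coloring of `G`: adjacent vertices receive distinct colors. -/
def Proper {V : Type*} (G : SimpleGraph V) (k : ℕ) (c : V → Fin k) : Prop :=
  ∀ ⦃u v : V⦄, G.Adj u v → c u ≠ c v

/-- Two proper `k`-colorings are adjacent if they differ on exactly one vertex. -/
def ColAdj {V : Type*} (G : SimpleGraph V) (k : ℕ) (c c' : V → Fin k) : Prop :=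
  Proper G k c ∧ Proper G k c' ∧ ∃! v, c v ≠ c' v

/-- `c` can be transformed into `c'` via single-vertex recolorings through
proper `k`-colorings. -/
def Reach {V : Type*} (G : SimpleGraph V) (k : ℕ) : (V → Fin k) → (V → Fin k) → Prop :=
  Relation.ReflTransGen (ColAdj G k)

/-- `G` is `k`-mixing: any proper `k`-coloring can be transformed into any other. -/
def Mixing {V : Type*} (G : SimpleGraph V) (k : ℕ) : Prop :=
  ∀ c c' : V → Fin k, Proper G k c → Proper G k c' → Reach G k c c'

/-- `G` is bipartite: it admits a proper `2`-coloring. -/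
def Bipartite {V : Type*} (G : SimpleGraph V) : Prop :=
  ∃ c : V → Fin 2, Proper G 2 c

/-- The join of `B` with the complete graph on `m` vertices. -/
def JoinK {V : Type*} (B : SimpleGraph V) (m : ℕ) : SimpleGraph (V ⊕ Fin m) :=
  SimpleGraph.fromRel fun x y =>
    match x, y with
    | Sum.inl u, Sum.inl v => B.Adj u v
    | Sum.inl _, Sum.inr _ => True
    | Sum.inr _, Sum.inl _ => True
    | Sum.inr i, Sum.inr j => i ≠ j

theorem Reach.symm {V : Type*} {G : SimpleGraph V} {k : ℕ} {c c' : V → Fin k}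
    (h : Reach G k c c') : Reach G k c' c := by
  have : Std.Symm (ColAdj G k) :=
    ⟨fun _ _ ⟨hc, hc', hu⟩ => ⟨hc', hc, by simpa only [ne_comm] using hu⟩⟩
  exact Relation.ReflTransGen.stdSymm.symm _ _ h

theorem Reach.proper {V : Type*} {G : SimpleGraph V} {k : ℕ} {c c' : V → Fin k}
    (hc : Proper G k c) (h : Reach G k c c') : Proper G k c' := by
  induction h with
  | refl => exact hc
  | tail _ h _ => exact h.2.1

/-- Two proper colorings that differ only on an independent set are reachable from each other. -/
theorem reach_of_differ_on_independent {V : Type*} [Fintype V] {G : SimpleGraph V} {k : ℕ}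
    {c c' : V → Fin k} (hc : Proper G k c) (hc' : Proper G k c')
    (hind : ∀ u v, G.Adj u v → c u = c' u ∨ c v = c' v) : Reach G k c c' := by
  classical
  have hproper : ∀ s : Finset V, Proper G k (s.piecewise c' c) := by
    intro s u v huv
    have h₁ := hc huv
    have h₂ := hc' huv
    simp only [Finset.piecewise]
    rcases hind u v huv with h | h <;> split_ifs <;> simp_all
  have key : ∀ s : Finset V, Reach G k c (s.piecewise c' c) := by
    intro s
    induction s using Finset.induction_on with
    | empty => rw [Finset.piecewise_empty]; exact .refl
    | insert a s ha ih =>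
      by_cases hac : c a = c' a
      · have : (insert a s).piecewise c' c = s.piecewise c' c := by
          rw [Finset.piecewise_insert, Function.update_eq_self_iff]
          simp [ha, hac]
        rwa [this]
      · refine ih.tail ⟨hproper _, hproper _, a, ?_, fun v hv => ?_⟩
        · simpa [ha] using hac
        · by_contra hva
          exact hv (by simp [Finset.piecewise, hva])
  simpa using key Finset.univ

/-- A proper `3`-coloring with at most two colors reaches one that avoids the color `2`. -/
theorem exists_reach_avoiding_two {V : Type*} [Fintype V] {G : SimpleGraph V}
    {c : V → Fin 3} (hc : Proper G 3 c) (hcard : (Set.range c).ncard ≤ 2) :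
    ∃ d : V → Fin 3, Reach G 3 c d ∧ ∀ v, d v ≠ 2 := by
  obtain ⟨z, hz⟩ : ∃ z, ∀ v, c v ≠ z := by
    by_contra! hsurj
    have : Set.range c = Set.univ := Set.range_eq_univ.2 hsurj
    simp [this] at hcard
  by_cases hz2 : z = 2
  · exact ⟨c, .refl, hz2 ▸ hz⟩
  · refine ⟨fun v => if c v = 2 then z else c v, reach_of_differ_on_independent hc ?_ ?_, ?_⟩
    · intro u v huv
      have h₁ := hc huv
      have h₂ := hz u
      have h₃ := hz v
      dsimp only
      grind
    · intro u v huv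
      have h₁ := hc huv
      grind
    · intro v
      grind

/-- A proper `3`-coloring avoiding the color `2` reaches every proper `2`-coloring. -/
theorem reach_of_avoids_two {V : Type*} [Fintype V] {G : SimpleGraph V} {b : V → Fin 2}
    (hb : Proper G 2 b) {d : V → Fin 3} (hd : Proper G 3 d) (hd2 : ∀ v, d v ≠ 2) :
    Reach G 3 d fun v => (b v).castSucc := by
  let d₁ : V → Fin 3 := fun v => if d v = 0 ∧ b v = 1 then 2 else d v
  let d₂ : V → Fin 3 := fun v => if b v = 0 then 0 else d₁ v
  have on_edge : ∀ p : Fin 3 → Fin 3 → Fin 2 → Fin 2 → Prop,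
      (∀ x y s t, x ≠ 2 → y ≠ 2 → x ≠ y → s ≠ t → p x y s t) →
      ∀ ⦃u v⦄, G.Adj u v → p (d u) (d v) (b u) (b v) :=
    fun p hp u v huv => hp _ _ _ _ (hd2 u) (hd2 v) (hd huv) (hb huv)
  have h₁ : Proper G 3 d₁ := on_edge (fun x y s t =>
    (if x = 0 ∧ s = 1 then 2 else x) ≠ (if y = 0 ∧ t = 1 then 2 else y)) (by decide)
  have h₂ : Proper G 3 d₂ := on_edge (fun x y s t =>
    (if s = 0 then 0 else if x = 0 ∧ s = 1 then 2 else x) ≠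
      (if t = 0 then 0 else if y = 0 ∧ t = 1 then 2 else y)) (by decide)
  have h₃ : Proper G 3 fun v => (b v).castSucc :=
    fun u v huv e => hb huv (Fin.castSucc_injective _ e)
  refine (reach_of_differ_on_independent hd h₁ ?_).trans
    ((reach_of_differ_on_independent h₁ h₂ ?_).trans
      (reach_of_differ_on_independent h₂ h₃ ?_))
  · exact on_edge (fun x y s t => x = (if x = 0 ∧ s = 1 then 2 else x) ∨
      y = (if y = 0 ∧ t = 1 then 2 else y)) (by decide)
  · exact on_edge (fun x y s t =>
      (if x = 0 ∧ s = 1 then 2 else x) = (if s = 0 then 0 else if x = 0 ∧ s = 1 then 2 else x) ∨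
      (if y = 0 ∧ t = 1 then 2 else y) = (if t = 0 then 0 else if y = 0 ∧ t = 1 then 2 else y))
      (by decide)
  · exact on_edge (fun x y s t =>
      (if s = 0 then 0 else if x = 0 ∧ s = 1 then 2 else x) = s.castSucc ∨
      (if t = 0 then 0 else if y = 0 ∧ t = 1 then 2 else y) = t.castSucc) (by decide)

/-- a bipartite graph in which every proper `3`-coloring can be
transformed into one using at most `2` colors is `3`-mixing. -/
theorem stmt1 {V : Type*} [Fintype V] (G : SimpleGraph V)
    (hbip : Bipartite G)
    (h : ∀ c : V → Fin 3, Proper G 3 c →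
      ∃ c' : V → Fin 3, Reach G 3 c c' ∧ (Set.range c').ncard ≤ 2) :
    Mixing G 3 := by
  obtain ⟨b, hb⟩ := hbip
  have key : ∀ c, Proper G 3 c → Reach G 3 c fun v => (b v).castSucc := by
    intro c hc
    obtain ⟨c', hcc', hcard⟩ := h c hc
    have hc' := hcc'.proper hc
    obtain ⟨d, hcd, hd2⟩ := exists_reach_avoiding_two hc' hcard
    exact hcc'.trans (hcd.trans (reach_of_avoids_two hb (hcd.proper hc') hd2))
  exact fun c c' hc hc' => (key c hc).trans (key c' hc').symm
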